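/- The bulk Boltzmann weights of the U_{q,p}(sl_3) ABF model satisfy the Yang–Baxter equation: for all u₁, u₂ ∈ ℝ and all heights a, b, c, d, e, f ∈ P for which every theta-function denominator appearing in the weights is nonzero, ∑_{g ∈ P} W(d,e;c,g|u₁) · W(c,g;b,a|u₂) · W(e,f;g,a|u₁−u₂) = ∑_{g ∈ P} W(g,f;b,a|u₁) · W(d,e;g,f|u₂) · W(d,g;c,b|u₁−u₂). (Each sum is finite since W vanishes unless consecutive heights differ by some ε̄_μ.) -/

import Mathlib

noncomputable section

open scoped BigOperators

attribute [local instance] Classical.propDecidable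

namespace ABF

/-- The ambient space `ℝ³`. -/
abbrev V : Type := Fin 3 → ℝ

/-- The standard inner product on `ℝ³`. -/
def ip (v w : V) : ℝ := ∑ i, v i * w i

/-- The orthonormal basis `ε_μ`. -/
def eps (μ : Fin 3) : V := fun ν => if ν = μ then 1 else 0

/-- `ε̄_μ = ε_μ − (ε₁+ε₂+ε₃)/3`. -/
def epsbar (μ : Fin 3) : V := eps μ - (1 / 3 : ℝ) • (eps 0 + eps 1 + eps 2)

/-- The `sl₃` weight lattice `P = ∑ ℤ ε̄_μ`. -/
def P : AddSubgroup V := AddSubgroup.closure (Set.range epsbar)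

/-- `ρ = 2ε̄₁ + ε̄₂`. -/
def rho : V := (2 : ℝ) • epsbar 0 + epsbar 1

/-- `a_μ = (a+ρ | ε̄_μ)`. -/
def ht (a : V) (μ : Fin 3) : ℝ := ip (a + rho) (epsbar μ)

/-- `a_{μ,ν} = a_μ − a_ν`. -/
def htd (a : V) (μ ν : Fin 3) : ℝ := ht a μ - ht a ν

/-- The infinite product `(z;q)_∞`. -/
def poch (z q : ℝ) : ℝ := ∏' j : ℕ, (1 - q ^ j * z)

/-- The double infinite product `(z;q₁,q₂)_∞`. -/
def poch2 (z q₁ q₂ : ℝ) : ℝ := ∏' p : ℕ × ℕ, (1 - q₁ ^ p.1 * q₂ ^ p.2 * z)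

/-- The theta function `Θ_q(z) = (q;q)_∞ (z;q)_∞ (q/z;q)_∞`. -/
def theta (q z : ℝ) : ℝ := poch q q * poch z q * poch (q / z) q

/-- The elliptic theta function `[u] = x^{u²/r−u} Θ_{x^{2r}}(x^{2u})`. -/
def bra (x r u : ℝ) : ℝ := x ^ (u ^ 2 / r - u) * theta (x ^ (2 * r)) (x ^ (2 * u))

/-- `h₁(z)`. -/
def h1fun (x r z : ℝ) : ℝ :=
  poch2 (x ^ (2 : ℝ) * z) (x ^ (2 * r)) (x ^ (6 : ℝ)) *
      poch2 (x ^ (2 * r + 4) * z) (x ^ (2 * r)) (x ^ (6 : ℝ)) /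
    (poch2 (x ^ (2 * r) * z) (x ^ (2 * r)) (x ^ (6 : ℝ)) *
      poch2 (x ^ (6 : ℝ) * z) (x ^ (2 * r)) (x ^ (6 : ℝ)))

/-- `r₁(u) = z^{2(r−1)/(3r)} h₁(z⁻¹)/h₁(z)`, `z = x^{2u}`. -/
def r1 (x r u : ℝ) : ℝ :=
  (x ^ (2 * u)) ^ (2 * (r - 1) / (3 * r)) * h1fun x r (x ^ (2 * u))⁻¹ / h1fun x r (x ^ (2 * u))

/-- `idx v = some μ` if `v = ε̄_μ`, and `none` otherwise. -/
def idx (v : V) : Option (Fin 3) :=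
  if h : ∃ μ : Fin 3, v = epsbar μ then some h.choose else none

/-- The bulk Boltzmann weight `W(a,b;c,d|u)` (top `a`, upper-right `b`, lower-left `c`,
bottom `d`):  it is `r₁(u)` on configurations `(d+2ε̄_μ, d+ε̄_μ; d+ε̄_μ, d)`,
`r₁(u)·[u][d_{μν}−1]/([u−1][d_{μν}])` on `(d+ε̄_μ+ε̄_ν, d+ε̄_μ; d+ε̄_ν, d)` with `μ ≠ ν`,
`r₁(u)·[u−d_{μν}][1]/([u−1][d_{μν}])` on `(d+ε̄_μ+ε̄_ν, d+ε̄_ν; d+ε̄_ν, d)` with `μ ≠ ν`,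
and `0` otherwise. -/
def W (x r : ℝ) (a b c d : V) (u : ℝ) : ℝ :=
  match idx (b - d), idx (a - b), idx (c - d), idx (a - c) with
  | some p, some q, some p', some q' =>
      if q = p ∧ p' = p ∧ q' = p then r1 x r u
      else if p ≠ q ∧ p' = q ∧ q' = p then
        r1 x r u * (bra x r u * bra x r (htd d p q - 1)) /
          (bra x r (u - 1) * bra x r (htd d p q))
      else if p ≠ q ∧ p' = p ∧ q' = q then
        r1 x r u * (bra x r (u - htd d q p) * bra x r 1) /
          (bra x r (u - 1) * bra x r (htd d q p))
      else 0
  | _, _, _, _ => 0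


/-- The Weierstrass three-term identity for an odd function. -/
def Weier (θ : ℝ → ℝ) : Prop := ∀ x y z t : ℝ,
  θ (x + y) * θ (x - y) * θ (z + t) * θ (z - t) - θ (x + z) * θ (x - z) * θ (y + t) * θ (y - t)
    + θ (x + t) * θ (x - t) * θ (y + z) * θ (y - z) = 0

/-- Off-diagonal weight without the scalar factor. -/
def bw (θ : ℝ → ℝ) (u s : ℝ) : ℝ := θ u * θ (s - 1) / (θ (u - 1) * θ s)

/-- Diagonal weight without the scalar factor. -/
def cw (θ : ℝ → ℝ) (u s : ℝ) : ℝ := θ (u - s) * θ 1 / (θ (u - 1) * θ s)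

lemma wei (θ : ℝ → ℝ) (hW : Weier θ) (x y z t A B C D E F G H I J K L : ℝ)
    (h : (x + y) / 2 = A ∧ (x - y) / 2 = B ∧ (z + t) / 2 = C ∧ (z - t) / 2 = D ∧
      (x + z) / 2 = E ∧ (x - z) / 2 = F ∧ (y + t) / 2 = G ∧ (y - t) / 2 = H ∧
      (x + t) / 2 = I ∧ (x - t) / 2 = J ∧ (y + z) / 2 = K ∧ (y - z) / 2 = L) :
    θ A * θ B * θ C * θ D - θ E * θ F * θ G * θ H + θ I * θ J * θ K * θ L = 0 := by
  obtain ⟨rfl, rfl, rfl, rfl, rfl, rfl, rfl, rfl, rfl, rfl, rfl, rfl⟩ := h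
  have := hW (x / 2) (y / 2) (z / 2) (t / 2)
  simpa only [add_div, sub_div] using this

lemma ybe_A1 (θ : ℝ → ℝ) (hodd : ∀ a, θ (-a) = -θ a) (hW : Weier θ) (v w s t : ℝ)
    (n0 : θ t ≠ 0) (n1 : θ s ≠ 0) (n2 : θ (s + t) ≠ 0) (n3 : θ (w - 1) ≠ 0) (n4 : θ (v - 1) ≠ 0) (n5 : θ (v + w - 1) ≠ 0) :
    cw θ v s * cw θ (v + w) t * cw θ w s + bw θ v s * cw θ (v + w) (s + t) * bw θ w (-s)
      = cw θ w t * cw θ (v + w) s * cw θ v t + bw θ w t * cw θ (v + w) (s + t) * bw θ v (-t) := by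
  simp only [bw, cw]
  simp only [show v + w - (s + t) = v + w - s - t by ring,
    show -s - 1 = -(s + 1) by ring,
    show -t - 1 = -(t + 1) by ring,
    hodd]
  have e0 := wei θ hW (2 * t) (-2) (2 * s) 0 (t - 1) (t + 1) s s
    (s + t) (-(s - t)) (-(1)) (-(1)) t t (s - 1) (-(s + 1))
    (by refine ⟨?_, ?_, ?_, ?_, ?_, ?_, ?_, ?_, ?_, ?_, ?_, ?_⟩ <;> ring)
  simp only [hodd] at e0
  have e1 := wei θ hW (w + t - s) (s + t - w) (2 * v + w - s - t) (t - w - s) t (w - s) (v - s) (v + w - t)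
    (v + w - s) (-(v - t)) (-(w - t)) s (-(s - t)) w v (-(v + w - s - t))
    (by refine ⟨?_, ?_, ?_, ?_, ?_, ?_, ?_, ?_, ?_, ?_, ?_, ?_⟩ <;> ring)
  simp only [hodd] at e1
  linear_combination (norm := (field_simp; ring)) θ 1 /
    (θ t * θ t * θ s * θ s * θ (w - 1) * θ (v - 1) * θ (v + w - 1) * θ (s + t)) *
    (-θ w * θ v * θ (v + w - s - t) * e0 + θ 1 * θ 1 * θ (s + t) * e1)

lemma ybe_A2 (θ : ℝ → ℝ) (hodd : ∀ a, θ (-a) = -θ a) (hW : Weier θ) (v w s t : ℝ)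
    (n0 : θ t ≠ 0) (n1 : θ s ≠ 0) (n2 : θ (s + t) ≠ 0) (n3 : θ (w - 1) ≠ 0) (n4 : θ (v - 1) ≠ 0) (n5 : θ (v + w - 1) ≠ 0) :
    cw θ v s * cw θ (v + w) t * bw θ w s + bw θ v s * cw θ (v + w) (s + t) * cw θ w (-s)
      = cw θ w t * bw θ (v + w) s * cw θ v (s + t) := by
  simp only [bw, cw]
  simp only [show v + w - (s + t) = v + w - s - t by ring,
    show w - (-s) = w + s by ring,
    show v - (s + t) = v - s - t by ring,
    hodd]
  have e0 := wei θ hW (w + s + t) (t - w - s) (2 * v + w - s - t) (s + t - w) t (w + s) v (v + w - s - t)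
    (v + w) (-(v - s - t)) (-(w - t)) (-(s)) (s + t) w (v - s) (-(v + w - t))
    (by refine ⟨?_, ?_, ?_, ?_, ?_, ?_, ?_, ?_, ?_, ?_, ?_, ?_⟩ <;> ring)
  simp only [hodd] at e0
  linear_combination (norm := (field_simp; ring)) θ 1 * θ 1 * θ (s - 1) /
    (θ t * θ s * θ s * θ (w - 1) * θ (v - 1) * θ (v + w - 1) * θ (s + t)) *
    (-e0)

lemma ybe_A3 (θ : ℝ → ℝ) (hodd : ∀ a, θ (-a) = -θ a) (hW : Weier θ) (v w s t : ℝ)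
    (n0 : θ t ≠ 0) (n1 : θ s ≠ 0) (n2 : θ (s + t) ≠ 0) (n3 : θ (w - 1) ≠ 0) (n4 : θ (v - 1) ≠ 0) (n5 : θ (v + w - 1) ≠ 0) :
    cw θ v s * bw θ (v + w) t * cw θ w (s + t)
      = cw θ w t * cw θ (v + w) s * bw θ v t + bw θ w t * cw θ (v + w) (s + t) * cw θ v (-t) := by
  simp only [bw, cw]
  simp only [show w - (s + t) = w - s - t by ring,
    show v + w - (s + t) = v + w - s - t by ring,
    show v - (-t) = v + t by ring,
    hodd]
  have e0 := wei θ hW (w - s) (s + 2 * t - w) (2 * v + w - s) (-w - s) t (w - s - t) (v - s) (v + w)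
    (v + w - s) (-(v)) (-(w - t)) (s + t) (-(s)) w (v + t) (-(v + w - s - t))
    (by refine ⟨?_, ?_, ?_, ?_, ?_, ?_, ?_, ?_, ?_, ?_, ?_, ?_⟩ <;> ring)
  simp only [hodd] at e0
  linear_combination (norm := (field_simp; ring)) θ 1 * θ 1 * θ (t - 1) /
    (θ t * θ t * θ s * θ (s + t) * θ (w - 1) * θ (v - 1) * θ (v + w - 1)) *
    (e0)

lemma ybe_A4 (θ : ℝ → ℝ) (_hodd : ∀ a, θ (-a) = -θ a) (_hW : Weier θ) (v w s t : ℝ)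
    (_n0 : θ t ≠ 0) (_n1 : θ s ≠ 0) (_n2 : θ (s + t) ≠ 0) (_n3 : θ (w - 1) ≠ 0) (_n4 : θ (v - 1) ≠ 0) (_n5 : θ (v + w - 1) ≠ 0) :
    cw θ v s * bw θ (v + w) t * bw θ w (s + t)
      = bw θ w t * bw θ (v + w) (s + t) * cw θ v s := by
  simp only [bw, cw]
  ring

lemma ybe_A5 (θ : ℝ → ℝ) (_hodd : ∀ a, θ (-a) = -θ a) (_hW : Weier θ) (v w s t : ℝ)
    (_n0 : θ t ≠ 0) (_n1 : θ s ≠ 0) (_n2 : θ (s + t) ≠ 0) (_n3 : θ (w - 1) ≠ 0) (_n4 : θ (v - 1) ≠ 0) (_n5 : θ (v + w - 1) ≠ 0) :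
    bw θ v s * bw θ (v + w) (s + t) * cw θ w t
      = cw θ w t * bw θ (v + w) s * bw θ v (s + t) := by
  simp only [bw, cw]
  ring

lemma ybe_A6 (θ : ℝ → ℝ) (_hodd : ∀ a, θ (-a) = -θ a) (_hW : Weier θ) (v w s t : ℝ)
    (_n0 : θ t ≠ 0) (_n1 : θ s ≠ 0) (_n2 : θ (s + t) ≠ 0) (_n3 : θ (w - 1) ≠ 0) (_n4 : θ (v - 1) ≠ 0) (_n5 : θ (v + w - 1) ≠ 0) :
    bw θ v s * bw θ (v + w) (s + t) * bw θ w t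
      = bw θ w t * bw θ (v + w) (s + t) * bw θ v s := by
  simp only [bw, cw]
  ring

lemma ybe_B1 (θ : ℝ → ℝ) (hodd : ∀ a, θ (-a) = -θ a) (hW : Weier θ) (v w s : ℝ)
    (n0 : θ (s - 1) ≠ 0) (n1 : θ s ≠ 0) (n2 : θ (w - 1) ≠ 0) (n3 : θ (v - 1) ≠ 0) (n4 : θ (v + w - 1) ≠ 0) :
    cw θ (v + w) (s - 1)
      = cw θ w (s - 1) * cw θ v (s - 1) + bw θ w (s - 1) * cw θ (v + w) s * bw θ v (1 - s) := by
  simp only [bw, cw]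
  simp only [show v + w - (s - 1) = v + w + 1 - s by ring,
    show w - (s - 1) = w + 1 - s by ring,
    show v - (s - 1) = v + 1 - s by ring,
    show s - 1 - 1 = s - 2 by ring,
    show 1 - s - 1 = -(s) by ring,
    hodd]
  simp only [show 1 - s = -(s - 1) by ring, hodd]
  have e0 := wei θ hW (w + 2 - s) (s - w) (2 * v + w - s) (2 - w - s) 1 (w + 1 - s) (v + 1 - s) (v + w - 1)
    (v + w + 1 - s) (-(v - 1)) (-(w - 1)) (s - 1) (-(s - 2)) w v (-(v + w - s))
    (by refine ⟨?_, ?_, ?_, ?_, ?_, ?_, ?_, ?_, ?_, ?_, ?_, ?_⟩ <;> ring)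
  simp only [hodd] at e0
  linear_combination (norm := (field_simp; ring)) θ 1 * θ s /
    (θ (s - 1) * θ (s - 1) * θ (v + w - 1) * θ (w - 1) * θ (v - 1) * θ s) *
    (-e0)

lemma ybe_B2 (θ : ℝ → ℝ) (hodd : ∀ a, θ (-a) = -θ a) (hW : Weier θ) (v w s : ℝ)
    (n0 : θ (s - 1) ≠ 0) (n1 : θ s ≠ 0) (n2 : θ (w - 1) ≠ 0) (n3 : θ (v - 1) ≠ 0) (n4 : θ (v + w - 1) ≠ 0) :
    bw θ (v + w) (s - 1) * cw θ w s
      = cw θ w (s - 1) * bw θ v (s - 1) + bw θ w (s - 1) * cw θ (v + w) s * cw θ v (1 - s) := by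
  simp only [bw, cw]
  simp only [show s - 1 - 1 = s - 2 by ring,
    show w - (s - 1) = w + 1 - s by ring,
    show v - (1 - s) = v + s - 1 by ring,
    hodd]
  simp only [show 1 - s = -(s - 1) by ring, hodd]
  have e0 := wei θ hW (w + 1) (1 - w) (2 * v + w - 1) (2 * s - w - 1) 1 w (v + s - 1) (v + w - s)
    (v + w) (-(v - 1)) (-(w - s)) (-(s - 1)) s (w + 1 - s) v (-(v + w - 1))
    (by refine ⟨?_, ?_, ?_, ?_, ?_, ?_, ?_, ?_, ?_, ?_, ?_, ?_⟩ <;> ring)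
  simp only [hodd] at e0
  linear_combination (norm := (field_simp; ring)) θ 1 * θ (s - 2) /
    (θ (s - 1) * θ (s - 1) * θ s * θ (w - 1) * θ (v + w - 1) * θ (v - 1)) *
    (e0)

lemma ybe_B3 (θ : ℝ → ℝ) (_hodd : ∀ a, θ (-a) = -θ a) (_hW : Weier θ) (v w s : ℝ)
    (_n0 : θ (s - 1) ≠ 0) (_n1 : θ s ≠ 0) (_n2 : θ (w - 1) ≠ 0) (_n3 : θ (v - 1) ≠ 0) (_n4 : θ (v + w - 1) ≠ 0) :
    bw θ (v + w) (s - 1) * bw θ w s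
      = bw θ w (s - 1) * bw θ (v + w) s := by
  simp only [bw, cw]
  simp only [show s - 1 - 1 = s - 2 by ring]
  ring

lemma ybe_B4 (θ : ℝ → ℝ) (hodd : ∀ a, θ (-a) = -θ a) (hW : Weier θ) (v w s : ℝ)
    (n0 : θ (s - 1) ≠ 0) (n1 : θ s ≠ 0) (n2 : θ (w - 1) ≠ 0) (n3 : θ (v - 1) ≠ 0) (n4 : θ (v + w - 1) ≠ 0) :
    cw θ v s * bw θ (v + w) (1 - s)
      = cw θ w (1 - s) * cw θ (v + w) s * bw θ v (1 - s) + bw θ w (1 - s) * cw θ v (s - 1) := by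
  simp only [bw, cw]
  simp only [show 1 - s - 1 = -(s) by ring,
    show w - (1 - s) = w + s - 1 by ring,
    show v - (s - 1) = v + 1 - s by ring,
    hodd]
  simp only [show 1 - s = -(s - 1) by ring, hodd]
  have e0 := wei θ hW (w + s) (2 - w - s) (2 * v + w - s) (s - w) 1 (w + s - 1) v (v + w - s)
    (v + w) (-(v - s)) (-(w - 1)) (-(s - 1)) s w (v + 1 - s) (-(v + w - 1))
    (by refine ⟨?_, ?_, ?_, ?_, ?_, ?_, ?_, ?_, ?_, ?_, ?_, ?_⟩ <;> ring)
  simp only [hodd] at e0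
  linear_combination (norm := (field_simp; ring)) θ 1 * θ s /
    (θ (s - 1) * θ (s - 1) * θ s * θ (v - 1) * θ (v + w - 1) * θ (w - 1)) *
    (e0)

lemma ybe_B5 (θ : ℝ → ℝ) (hodd : ∀ a, θ (-a) = -θ a) (hW : Weier θ) (v w s : ℝ)
    (n0 : θ (s - 1) ≠ 0) (n1 : θ s ≠ 0) (n2 : θ (w - 1) ≠ 0) (n3 : θ (v - 1) ≠ 0) (n4 : θ (v + w - 1) ≠ 0) :
    cw θ v s * cw θ (v + w) (1 - s) * cw θ w s + bw θ v s * bw θ w (-s)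
      = cw θ w (1 - s) * cw θ (v + w) s * cw θ v (1 - s) + bw θ w (1 - s) * bw θ v (s - 1) := by
  simp only [bw, cw]
  simp only [show v + w - (1 - s) = v + w + s - 1 by ring,
    show -s - 1 = -(s + 1) by ring,
    show w - (1 - s) = w + s - 1 by ring,
    show v - (1 - s) = v + s - 1 by ring,
    show 1 - s - 1 = -(s) by ring,
    show s - 1 - 1 = s - 2 by ring,
    hodd]
  simp only [show 1 - s = -(s - 1) by ring, hodd]
  have e0 := wei θ hW (2 * s - 2) (-2) (2 * s) 0 (s - 2) s s s
    (2 * s - 1) (-(1)) (-(1)) (-(1)) (s - 1) (s - 1) (s - 1) (-(s + 1))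
    (by refine ⟨?_, ?_, ?_, ?_, ?_, ?_, ?_, ?_, ?_, ?_, ?_, ?_⟩ <;> ring)
  simp only [hodd] at e0
  have e1 := wei θ hW (w - 1) (2 * s - w - 1) (2 * v + w - 1) (1 - w - 2 * s) (s - 1) (w - s) (v - s) (v + w + s - 1)
    (v + w - 1) (-(v)) (-(w)) (2 * s - 1) (-(s)) (w + s - 1) (v + s - 1) (-(v + w - s))
    (by refine ⟨?_, ?_, ?_, ?_, ?_, ?_, ?_, ?_, ?_, ?_, ?_, ?_⟩ <;> ring)
  simp only [hodd] at e1
  linear_combination (norm := (field_simp; ring)) 1 /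
    (θ (s - 1) * θ (s - 1) * θ s * θ s * θ (w - 1) * θ (v - 1) * θ (v + w - 1)) *
    (-θ w * θ v * θ (v + w - 1) * e0 + -θ 1 * θ 1 * θ 1 * e1)

lemma ybe_B6 (θ : ℝ → ℝ) (hodd : ∀ a, θ (-a) = -θ a) (hW : Weier θ) (v w s : ℝ)
    (n0 : θ (s - 1) ≠ 0) (n1 : θ s ≠ 0) (n2 : θ (w - 1) ≠ 0) (n3 : θ (v - 1) ≠ 0) (n4 : θ (v + w - 1) ≠ 0) :
    cw θ v s * cw θ (v + w) (1 - s) * bw θ w s + bw θ v s * cw θ w (-s)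
      = cw θ w (1 - s) * bw θ (v + w) s := by
  simp only [bw, cw]
  simp only [show v + w - (1 - s) = v + w + s - 1 by ring,
    show w - (-s) = w + s by ring,
    show w - (1 - s) = w + s - 1 by ring,
    hodd]
  simp only [show 1 - s = -(s - 1) by ring, hodd]
  have e0 := wei θ hW (w + 1) (1 - w) (2 * v + w - 1) (1 - w - 2 * s) 1 w (v - s) (v + w + s - 1)
    (v + w) (-(v - 1)) (-(w + s - 1)) s (-(s - 1)) (w + s) v (-(v + w - 1))
    (by refine ⟨?_, ?_, ?_, ?_, ?_, ?_, ?_, ?_, ?_, ?_, ?_, ?_⟩ <;> ring)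
  simp only [hodd] at e0
  linear_combination (norm := (field_simp; ring)) θ 1 * θ (s - 1) /
    (θ (s - 1) * θ s * θ s * θ (w - 1) * θ (v - 1) * θ (v + w - 1)) *
    (-e0)

lemma ybe_B7 (θ : ℝ → ℝ) (hodd : ∀ a, θ (-a) = -θ a) (_hW : Weier θ) (v w s : ℝ)
    (_n0 : θ (s - 1) ≠ 0) (_n1 : θ s ≠ 0) (_n2 : θ (w - 1) ≠ 0) (_n3 : θ (v - 1) ≠ 0) (_n4 : θ (v + w - 1) ≠ 0) :
    bw θ v (-s) * bw θ (v + w) (1 - s)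
      = bw θ (v + w) (-s) * bw θ v (1 - s) := by
  simp only [bw, cw]
  simp only [show -s - 1 = -(s + 1) by ring,
    show 1 - s - 1 = -(s) by ring,
    hodd]
  simp only [show 1 - s = -(s - 1) by ring, hodd]
  ring

lemma ybe_B8 (θ : ℝ → ℝ) (hodd : ∀ a, θ (-a) = -θ a) (hW : Weier θ) (v w s : ℝ)
    (n0 : θ (s - 1) ≠ 0) (n1 : θ s ≠ 0) (n2 : θ (w - 1) ≠ 0) (n3 : θ (v - 1) ≠ 0) (n4 : θ (v + w - 1) ≠ 0) :
    cw θ v (-s) * bw θ w (-s) + bw θ v (-s) * cw θ (v + w) (1 - s) * cw θ w s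
      = bw θ (v + w) (-s) * cw θ v (1 - s) := by
  simp only [bw, cw]
  simp only [show v - (-s) = v + s by ring,
    show -s - 1 = -(s + 1) by ring,
    show v + w - (1 - s) = v + w + s - 1 by ring,
    show v - (1 - s) = v + s - 1 by ring,
    hodd]
  simp only [show 1 - s = -(s - 1) by ring, hodd]
  have e0 := wei θ hW (w + 1 - s) (s + 1 - w) (2 * v + w + s - 1) (1 - w - s) 1 (w - s) v (v + w + s - 1)
    (v + w) (-(v + s - 1)) (-(w - 1)) s (-(s - 1)) w (v + s) (-(v + w - 1))
    (by refine ⟨?_, ?_, ?_, ?_, ?_, ?_, ?_, ?_, ?_, ?_, ?_, ?_⟩ <;> ring)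
  simp only [hodd] at e0
  linear_combination (norm := (field_simp; ring)) θ 1 * θ (s + 1) /
    (θ s * θ s * θ (w - 1) * θ (v - 1) * θ (s - 1) * θ (v + w - 1)) *
    (-e0)

lemma ybe_B9 (θ : ℝ → ℝ) (hodd : ∀ a, θ (-a) = -θ a) (hW : Weier θ) (v w s : ℝ)
    (n0 : θ (s - 1) ≠ 0) (n1 : θ s ≠ 0) (n2 : θ (w - 1) ≠ 0) (n3 : θ (v - 1) ≠ 0) (n4 : θ (v + w - 1) ≠ 0) :
    cw θ v (-s) * cw θ w (-s) + bw θ v (-s) * cw θ (v + w) (1 - s) * bw θ w s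
      = cw θ (v + w) (-s) := by
  simp only [bw, cw]
  simp only [show v - (-s) = v + s by ring,
    show w - (-s) = w + s by ring,
    show -s - 1 = -(s + 1) by ring,
    show v + w - (1 - s) = v + w + s - 1 by ring,
    show v + w - (-s) = v + w + s by ring,
    hodd]
  simp only [show 1 - s = -(s - 1) by ring, hodd]
  have e0 := wei θ hW (w + s + 1) (1 - w - s) (2 * v + w + s - 1) (s + 1 - w) 1 (w + s) (v + s) (v + w - 1)
    (v + w + s) (-(v - 1)) (-(w - 1)) (-(s)) (s + 1) w v (-(v + w + s - 1))
    (by refine ⟨?_, ?_, ?_, ?_, ?_, ?_, ?_, ?_, ?_, ?_, ?_, ?_⟩ <;> ring)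
  simp only [hodd] at e0
  linear_combination (norm := (field_simp; ring)) θ 1 * θ (s - 1) /
    (θ s * θ s * θ (w - 1) * θ (v - 1) * θ (s - 1) * θ (v + w - 1)) *
    (e0)

/-- Boltzmann weight without scalar factor, in terms of steps. -/
def Wc (θ : ℝ → ℝ) (D : Fin 3 → Fin 3 → ℝ) (p q p' q' : Fin 3) (u : ℝ) : ℝ :=
  if q = p ∧ p' = p ∧ q' = p then 1
  else if p ≠ q ∧ p' = q ∧ q' = p then bw θ u (D p q)
  else if p ≠ q ∧ p' = p ∧ q' = q then cw θ u (D q p)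
  else 0

/-- The transfer operator on functions of two steps. -/
def Top (θ : ℝ → ℝ) (D : Fin 3 → Fin 3 → ℝ) (u : ℝ) (F : Fin 3 → Fin 3 → ℝ) (p q : Fin 3) : ℝ :=
  if p = q then F p p else bw θ u (D q p) * F q p + cw θ u (D q p) * F p q

lemma Top_same (θ : ℝ → ℝ) (D : Fin 3 → Fin 3 → ℝ) (u : ℝ) (F : Fin 3 → Fin 3 → ℝ) (p : Fin 3) :
    Top θ D u F p p = F p p := by simp [Top]

lemma Top_ne (θ : ℝ → ℝ) (D : Fin 3 → Fin 3 → ℝ) (u : ℝ) (F : Fin 3 → Fin 3 → ℝ) (p q : Fin 3)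
    (h : p ≠ q) :
    Top θ D u F p q = bw θ u (D q p) * F q p + cw θ u (D q p) * F p q := by simp [Top, h]

lemma sum_Wc (θ : ℝ → ℝ) (D : Fin 3 → Fin 3 → ℝ) (u : ℝ) (F : Fin 3 → Fin 3 → ℝ) (p' q' : Fin 3) :
    ∑ p, ∑ q, Wc θ D p q p' q' u * F p q = Top θ D u F p' q' := by
  fin_cases p' <;> fin_cases q' <;> simp [Fin.sum_univ_three, Wc, Top] <;> ring

/-- Shifted height differences. -/
def sh (D : Fin 3 → Fin 3 → ℝ) (κ : Fin 3) (p q : Fin 3) : ℝ :=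
  D p q + (if κ = p then 1 else 0) - (if κ = q then 1 else 0)

lemma ybe_Top (θ : ℝ → ℝ) (hodd : ∀ a, θ (-a) = -θ a) (hW : Weier θ) (D : Fin 3 → Fin 3 → ℝ)
    (hD : ∀ p q, D q p = -D p q) (hD3 : ∀ p q k, D p q + D q k = D p k) (v w : ℝ)
    (nv : θ (v - 1) ≠ 0) (nw : θ (w - 1) ≠ 0) (nu : θ (v + w - 1) ≠ 0)
    (nD : ∀ p q, p ≠ q → θ (D p q) ≠ 0) (nS : ∀ κ p q, p ≠ q → θ (sh D κ p q) ≠ 0)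
    (ψ : Fin 3 → Fin 3 → Fin 3 → ℝ) (p1 p2 p3 : Fin 3) :
    Top θ D v (fun κ m' => Top θ (sh D κ) (v + w)
        (fun m n => Top θ D w (fun l l' => ψ l l' n) κ m) m' p3) p1 p2
      = Top θ (sh D p1) w (fun κ m' => Top θ D (v + w)
        (fun l m => Top θ (sh D l) v (fun l2 l3 => ψ l l2 l3) m m') p1 κ) p2 p3 := by
  have S1 : ∀ i j, i ≠ j → sh D i j i = D j i - 1 := by
    intro i j h; simp [sh, h]
  have S2 : ∀ i j, i ≠ j → sh D i i j = 1 - D j i := by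
    intro i j h; simp [sh, h, hD j i]; ring
  have S3 : ∀ i j k, i ≠ j → i ≠ k → sh D i j k = D j k := by
    intro i j k h h'; simp [sh, h, h']
  have nm : ∀ i j, i ≠ j → θ (D j i - 1) ≠ 0 := fun i j h => by
    rw [← S1 i j h]; exact nS i j i h.symm
  by_cases h12 : p1 = p2
  · subst h12
    by_cases h13 : p1 = p3
    · subst h13
      simp only [Top_same]
    · have h31 : p3 ≠ p1 := fun h => h13 h.symm
      have n0 := nD p3 p1 h31
      have n1 := nm p1 p3 h13
      simp only [Top_same, Top_ne _ _ _ _ _ _ h13, Top_ne _ _ _ _ _ _ h31, S1 _ _ h13, S2 _ _ h13]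
      linear_combination ψ p1 p1 p3 * ybe_B1 θ hodd hW v w _ n1 n0 nw nv nu
        + ψ p1 p3 p1 * ybe_B2 θ hodd hW v w _ n1 n0 nw nv nu
        + ψ p3 p1 p1 * ybe_B3 θ hodd hW v w _ n1 n0 nw nv nu
  · have h21 : p2 ≠ p1 := fun h => h12 h.symm
    by_cases h13 : p1 = p3
    · subst h13
      simp only [Top_same, Top_ne _ _ _ _ _ _ h12, Top_ne _ _ _ _ _ _ h21, S1 _ _ h12, S2 _ _ h12]
      rw [hD p2 p1]
      have n0 := nD p2 p1 h21
      have n1 := nm p1 p2 h12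
      linear_combination ψ p1 p1 p2 * ybe_B4 θ hodd hW v w _ n1 n0 nw nv nu
        + ψ p1 p2 p1 * ybe_B5 θ hodd hW v w _ n1 n0 nw nv nu
        + ψ p2 p1 p1 * ybe_B6 θ hodd hW v w _ n1 n0 nw nv nu
    · have h31 : p3 ≠ p1 := fun h => h13 h.symm
      by_cases h23 : p2 = p3
      · subst h23
        simp only [Top_same, Top_ne _ _ _ _ _ _ h12, Top_ne _ _ _ _ _ _ h21, S1 _ _ h21, S2 _ _ h21]
        rw [hD p1 p2]
        have n0 := nD p1 p2 h12
        have n1 := nm p2 p1 h21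
        linear_combination ψ p2 p2 p1 * ybe_B7 θ hodd hW v w _ n1 n0 nw nv nu
          + ψ p2 p1 p2 * ybe_B8 θ hodd hW v w _ n1 n0 nw nv nu
          + ψ p1 p2 p2 * ybe_B9 θ hodd hW v w _ n1 n0 nw nv nu
      · have h32 : p3 ≠ p2 := fun h => h23 h.symm
        simp only [Top_same, Top_ne _ _ _ _ _ _ h12, Top_ne _ _ _ _ _ _ h21, Top_ne _ _ _ _ _ _ h13, Top_ne _ _ _ _ _ _ h31,
          Top_ne _ _ _ _ _ _ h23, Top_ne _ _ _ _ _ _ h32,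
          S3 _ _ _ h12 h13, S3 _ _ _ h13 h12, S3 _ _ _ h21 h23, S3 _ _ _ h23 h21, S3 _ _ _ h31 h32, S3 _ _ _ h32 h31]
        have n0 := nD p2 p1 h21
        have n1 := nD p3 p2 h32
        have n2 := nD p3 p1 h31
        have e31 : D p3 p1 = D p2 p1 + D p3 p2 := by rw [← hD3 p3 p2 p1]; ring
        rw [e31] at n2
        rw [hD p2 p1, hD p3 p2, e31]
        linear_combination ψ p1 p2 p3 * ybe_A1 θ hodd hW v w _ _ n1 n0 n2 nw nv nu
          + ψ p2 p1 p3 * ybe_A2 θ hodd hW v w _ _ n1 n0 n2 nw nv nu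
          + ψ p1 p3 p2 * ybe_A3 θ hodd hW v w _ _ n1 n0 n2 nw nv nu
          + ψ p3 p1 p2 * ybe_A4 θ hodd hW v w _ _ n1 n0 n2 nw nv nu
          + ψ p2 p3 p1 * ybe_A5 θ hodd hW v w _ _ n1 n0 n2 nw nv nu
          + ψ p3 p2 p1 * ybe_A6 θ hodd hW v w _ _ n1 n0 n2 nw nv nu

lemma epsbar_inj {μ ν : Fin 3} (h : epsbar μ = epsbar ν) : μ = ν := by
  by_contra hne
  have h1 := congrFun h μ
  simp [epsbar, eps, hne] at h1
  linarith

lemma idx_eq_some {v : V} {μ : Fin 3} : idx v = some μ ↔ v = epsbar μ := by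
  unfold idx
  constructor
  · intro h
    split_ifs at h with h'
    have := h'.choose_spec
    simp only [Option.some.injEq] at h
    rwa [h] at this
  · intro h
    have h' : ∃ μ : Fin 3, v = epsbar μ := ⟨μ, h⟩
    rw [dif_pos h']
    congr 1
    exact epsbar_inj (h'.choose_spec.symm.trans h)

lemma W_eq (x r : ℝ) {a b c d : V} (u : ℝ) {p q p' q' : Fin 3} (hb : b = d + epsbar p)
    (ha : a = b + epsbar q) (hc : c = d + epsbar p') (ha' : a = c + epsbar q') :
    W x r a b c d u = r1 x r u * Wc (bra x r) (htd d) p q p' q' u := by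
  have e1 : idx (b - d) = some p := idx_eq_some.2 (by rw [hb]; abel)
  have e2 : idx (a - b) = some q := idx_eq_some.2 (by rw [ha]; abel)
  have e3 : idx (c - d) = some p' := idx_eq_some.2 (by rw [hc]; abel)
  have e4 : idx (a - c) = some q' := idx_eq_some.2 (by rw [ha']; abel)
  unfold W Wc bw cw
  rw [e1, e2, e3, e4]
  dsimp only
  split_ifs <;> ring

lemma W_ne (x r : ℝ) {a b c d : V} {u : ℝ} (h : W x r a b c d u ≠ 0) :
    (∃ p, b = d + epsbar p) ∧ (∃ q, a = b + epsbar q) ∧ (∃ p', c = d + epsbar p') ∧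
      (∃ q', a = c + epsbar q') := by
  unfold W at h
  split at h
  · rename_i p q p' q' h1 h2 h3 h4
    rw [idx_eq_some] at h1 h2 h3 h4
    exact ⟨⟨p, by rw [← h1]; abel⟩, ⟨q, by rw [← h2]; abel⟩, ⟨p', by rw [← h3]; abel⟩,
      ⟨q', by rw [← h4]; abel⟩⟩
  · exact absurd rfl h

lemma Wc_ne {θ : ℝ → ℝ} {D : Fin 3 → Fin 3 → ℝ} {p q p' q' : Fin 3} {u : ℝ}
    (h : Wc θ D p q p' q' u ≠ 0) : epsbar p + epsbar q = epsbar p' + epsbar q' := by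
  unfold Wc at h
  split_ifs at h with h1 h2 h3
  · obtain ⟨rfl, rfl, rfl⟩ := h1; rfl
  · obtain ⟨_, rfl, rfl⟩ := h2; abel
  · obtain ⟨_, rfl, rfl⟩ := h3; rfl
  · exact absurd rfl h

lemma collapse (A B : Fin 3 → Prop) (hA : ∀ m n, A m → A n → m = n) (hB : ∀ m n, B m → B n → m = n)
    (G : Fin 3 → Fin 3 → ℝ) (hG : ∀ m m', G m m' ≠ 0 → A m ∧ B m') (t : ℝ)
    (h1 : ∀ m m', A m → B m' → t = G m m') (h0 : t ≠ 0 → (∃ m, A m) ∧ (∃ m', B m')) :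
    t = ∑ m, ∑ m', G m m' := by
  by_cases h : (∃ m, A m) ∧ (∃ m', B m')
  · obtain ⟨⟨m, hm⟩, ⟨m', hm'⟩⟩ := h
    rw [Finset.sum_eq_single m, Finset.sum_eq_single m', h1 m m' hm hm']
    · intro n _ hn
      by_contra hne
      exact hn (hB _ _ (hG _ _ hne).2 hm')
    · simp
    · intro n _ hn
      refine Finset.sum_eq_zero fun k _ => ?_
      by_contra hne
      exact hn (hA _ _ (hG _ _ hne).1 hm)
    · simp
  · have ht : t = 0 := by
      by_contra hne
      exact h (h0 hne)
    rw [ht, eq_comm]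
    refine Finset.sum_eq_zero fun m _ => Finset.sum_eq_zero fun m' _ => ?_
    by_contra hne
    exact h ⟨⟨m, (hG _ _ hne).1⟩, ⟨m', (hG _ _ hne).2⟩⟩

lemma htd_shift (a : V) (κ p q : Fin 3) : htd (a + epsbar κ) p q = sh (htd a) κ p q := by
  fin_cases κ <;> fin_cases p <;> fin_cases q <;>
    simp [htd, sh, ht, ip, epsbar, eps, Fin.sum_univ_three] <;> ring

lemma epsbar_mem (κ : Fin 3) : epsbar κ ∈ P := AddSubgroup.subset_closure ⟨κ, rfl⟩

lemma finsum_P (b : V) (hb : b ∈ P) (F : V → ℝ) (hF : ∀ g, F g ≠ 0 → ∃ κ, g = b + epsbar κ) :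
    ∑ᶠ g : P, F (g : V) = ∑ κ : Fin 3, F (b + epsbar κ) := by
  classical
  let i : Fin 3 → P := fun κ => ⟨b + epsbar κ, P.add_mem hb (epsbar_mem κ)⟩
  have hi : Function.Injective i := fun m n h => by
    have : b + epsbar m = b + epsbar n := congrArg Subtype.val h
    exact epsbar_inj (add_left_cancel this)
  rw [finsum_eq_sum_of_support_subset (s := Finset.univ.image i), Finset.sum_image]
  · exact fun m _ n _ h => hi h
  · intro g hg
    obtain ⟨κ, hκ⟩ := hF g hg
    simp only [Finset.coe_image, Finset.coe_univ, Set.image_univ, Set.mem_range]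
    exact ⟨κ, Subtype.ext hκ.symm⟩

lemma lhs_Top (θ : ℝ → ℝ) (D : Fin 3 → Fin 3 → ℝ) (v w : ℝ) (p1 p2 p3 q1 q2 q3 : Fin 3) :
    ∑ κ, ∑ m, ∑ m', Wc θ (sh D κ) m q3 m' p3 (v + w) * Wc θ D κ m' p1 p2 v * Wc θ D q1 q2 κ m w
      = Top θ D v (fun κ m' => Top θ (sh D κ) (v + w)
        (fun m n => Top θ D w (fun l l' => if l' = q2 then if l = q1 then if n = q3 then 1 else 0
          else 0 else 0) κ m) m' p3) p1 p2 := by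
  simp only [← sum_Wc, mul_ite, mul_one, mul_zero, Finset.sum_ite_eq', Finset.mem_univ, if_true,
    Finset.mul_sum]
  refine Finset.sum_congr rfl fun κ _ => ?_
  rw [Finset.sum_comm]
  refine Finset.sum_congr rfl fun m' _ => Finset.sum_congr rfl fun m _ => ?_
  ring

lemma rhs_Top (θ : ℝ → ℝ) (D : Fin 3 → Fin 3 → ℝ) (v w : ℝ) (p1 p2 p3 q1 q2 q3 : Fin 3) :
    ∑ κ, ∑ m, ∑ m', Wc θ D q1 m p1 κ (v + w) * Wc θ (sh D q1) q2 q3 m m' v *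
        Wc θ (sh D p1) κ m' p2 p3 w
      = Top θ (sh D p1) w (fun κ m' => Top θ D (v + w)
        (fun l m => Top θ (sh D l) v (fun l2 l3 => if l2 = q2 then if l = q1 then if l3 = q3 then 1
          else 0 else 0 else 0) m m') p1 κ) p2 p3 := by
  simp only [← sum_Wc, mul_ite, mul_one, mul_zero, Finset.sum_ite_eq', Finset.mem_univ, if_true,
    Finset.mul_sum]
  refine Finset.sum_congr rfl fun κ _ => ?_
  rw [Finset.sum_comm]
  refine Finset.sum_congr rfl fun m' _ => ?_
  symm
  rw [Finset.sum_comm]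
  refine Finset.sum_congr rfl fun m _ => ?_
  rw [Finset.sum_eq_single q1 (fun b _ hb => by simp [hb]) (by simp),
    Finset.sum_eq_single q2 (fun b _ hb => by simp [hb]) (by simp),
    Finset.sum_eq_single q3 (fun b _ hb => by simp [hb]) (by simp)]
  simp only [if_true]
  ring

/-- Reduction of the Yang–Baxter equation to the Weierstrass identity. -/
lemma ybe_of_weier
    (x : ℝ) (r : ℝ) (hodd : ∀ a, bra x r (-a) = -bra x r a) (hW : Weier (bra x r))
    (u₁ u₂ : ℝ) (a b c d e f : V)
    (ha : a ∈ P) (hb : b ∈ P)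
    (hden₁ : bra x r (u₁ - 1) ≠ 0) (hden₂ : bra x r (u₂ - 1) ≠ 0)
    (hden₁₂ : bra x r (u₁ - u₂ - 1) ≠ 0)
    (hA : ∀ μ ν : Fin 3, μ ≠ ν → bra x r (htd a μ ν) ≠ 0)
    (hAs : ∀ κ μ ν : Fin 3, μ ≠ ν → bra x r (htd (a + epsbar κ) μ ν) ≠ 0) :
    ∑ᶠ g : P, W x r d e c (g : V) u₁ * W x r c (g : V) b a u₂ * W x r e f (g : V) a (u₁ - u₂)
      = ∑ᶠ g : P,
          W x r (g : V) f b a u₁ * W x r d e (g : V) f u₂ * W x r d (g : V) c b (u₁ - u₂) := by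
  rw [finsum_P a ha (fun g => W x r d e c g u₁ * W x r c g b a u₂ * W x r e f g a (u₁ - u₂)),
    finsum_P b hb (fun g => W x r g f b a u₁ * W x r d e g f u₂ * W x r d g c b (u₁ - u₂))]
  rotate_left
  · intro g hg
    exact (W_ne x r (right_ne_zero_of_mul hg)).1
  · intro g hg
    exact (W_ne x r (right_ne_zero_of_mul (left_ne_zero_of_mul hg))).1
  by_cases hex : (∃ p1, b = a + epsbar p1) ∧ (∃ p2, c = b + epsbar p2) ∧ (∃ p3, d = c + epsbar p3) ∧
      (∃ q1, f = a + epsbar q1) ∧ (∃ q2, e = f + epsbar q2) ∧ (∃ q3, d = e + epsbar q3)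
  swap
  · rw [Finset.sum_eq_zero, Finset.sum_eq_zero]
    · intro κ _
      by_contra hne
      have h3 := W_ne x r (right_ne_zero_of_mul hne)
      have h2 := W_ne x r (right_ne_zero_of_mul (left_ne_zero_of_mul hne))
      have h1 := W_ne x r (left_ne_zero_of_mul (left_ne_zero_of_mul hne))
      exact hex ⟨h1.2.2.1, h3.2.2.1, h3.2.2.2, h1.1, h2.1, h2.2.1⟩
    · intro κ _
      by_contra hne
      have h3 := W_ne x r (right_ne_zero_of_mul hne)
      have h2 := W_ne x r (right_ne_zero_of_mul (left_ne_zero_of_mul hne))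
      have h1 := W_ne x r (left_ne_zero_of_mul (left_ne_zero_of_mul hne))
      exact hex ⟨h2.2.2.1, h2.2.2.2, h1.2.2.2, h3.1, h3.2.1, h1.2.1⟩
  obtain ⟨⟨p1, hb1⟩, ⟨p2, hc1⟩, ⟨p3, hd1⟩, ⟨q1, hf1⟩, ⟨q2, he1⟩, ⟨q3, hd2⟩⟩ := hex
  have hL : ∀ κ, W x r d e c (a + epsbar κ) u₁ * W x r c (a + epsbar κ) b a u₂ *
      W x r e f (a + epsbar κ) a (u₁ - u₂) = ∑ m, ∑ m', (r1 x r u₁ * r1 x r u₂ * r1 x r (u₁ - u₂)) *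
      (Wc (bra x r) (sh (htd a) κ) m q3 m' p3 u₁ * Wc (bra x r) (htd a) κ m' p1 p2 u₂ *
        Wc (bra x r) (htd a) q1 q2 κ m (u₁ - u₂)) := by
    intro κ
    refine collapse (fun m => e = a + epsbar κ + epsbar m) (fun m => c = a + epsbar κ + epsbar m)
      ?_ ?_ _ ?_ _ ?_ ?_
    · exact fun m n h h' => epsbar_inj (add_left_cancel (h.symm.trans h'))
    · exact fun m n h h' => epsbar_inj (add_left_cancel (h.symm.trans h'))
    · intro m m' hne
      have hne := right_ne_zero_of_mul hne
      have h3 := Wc_ne (right_ne_zero_of_mul hne)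
      have h2 := Wc_ne (right_ne_zero_of_mul (left_ne_zero_of_mul hne))
      constructor
      · rw [he1, hf1, add_assoc, add_assoc, h3]
      · rw [hc1, hb1, add_assoc, add_assoc, h2]
    · intro m m' hm hm'
      rw [W_eq x r u₁ hm hd2 hm' hd1, W_eq x r u₂ rfl hm' hb1 hc1,
        W_eq x r (u₁ - u₂) hf1 he1 rfl hm, show htd (a + epsbar κ) = sh (htd a) κ from
          funext fun _ => funext fun _ => htd_shift _ _ _ _]
      ring
    · intro hne
      have h1 := W_ne x r (left_ne_zero_of_mul (left_ne_zero_of_mul hne))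
      exact ⟨h1.1, h1.2.2.1⟩
  have hR : ∀ κ, W x r (b + epsbar κ) f b a u₁ * W x r d e (b + epsbar κ) f u₂ *
      W x r d (b + epsbar κ) c b (u₁ - u₂) = ∑ m, ∑ m', (r1 x r u₁ * r1 x r u₂ * r1 x r (u₁ - u₂)) *
      (Wc (bra x r) (htd a) q1 m p1 κ u₁ * Wc (bra x r) (sh (htd a) q1) q2 q3 m m' u₂ *
        Wc (bra x r) (sh (htd a) p1) κ m' p2 p3 (u₁ - u₂)) := by
    intro κ
    refine collapse (fun m => b + epsbar κ = f + epsbar m) (fun m => d = b + epsbar κ + epsbar m)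
      ?_ ?_ _ ?_ _ ?_ ?_
    · exact fun m n h h' => epsbar_inj (add_left_cancel (h.symm.trans h'))
    · exact fun m n h h' => epsbar_inj (add_left_cancel (h.symm.trans h'))
    · intro m m' hne
      have hne := right_ne_zero_of_mul hne
      have h3 := Wc_ne (right_ne_zero_of_mul hne)
      have h1 := Wc_ne (left_ne_zero_of_mul (left_ne_zero_of_mul hne))
      constructor
      · rw [hb1, hf1, add_assoc, add_assoc, h1]
      · rw [hd1, hc1, add_assoc, add_assoc, h3]
    · intro m m' hm hm'
      rw [W_eq x r u₁ hf1 hm hb1 rfl, W_eq x r u₂ he1 hd2 hm hm',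
        W_eq x r (u₁ - u₂) rfl hm' hc1 hd1, show htd f = sh (htd a) q1 from
          funext fun _ => funext fun _ => by rw [hf1]; exact htd_shift _ _ _ _,
        show htd b = sh (htd a) p1 from
          funext fun _ => funext fun _ => by rw [hb1]; exact htd_shift _ _ _ _]
      ring
    · intro hne
      have h2 := W_ne x r (right_ne_zero_of_mul (left_ne_zero_of_mul hne))
      exact ⟨h2.2.2.1, h2.2.2.2⟩
  simp only [hL, hR, ← Finset.mul_sum]
  congr 1
  have hu : u₁ = u₂ + (u₁ - u₂) := by ring
  have l := lhs_Top (bra x r) (htd a) u₂ (u₁ - u₂) p1 p2 p3 q1 q2 q3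
  have rr := rhs_Top (bra x r) (htd a) u₂ (u₁ - u₂) p1 p2 p3 q1 q2 q3
  have y := ybe_Top (bra x r) hodd hW (htd a) (fun p q => by simp [htd])
    (fun p q k => by simp [htd]) u₂ (u₁ - u₂) hden₂ hden₁₂ (by rw [← hu]; exact hden₁) hA
    (fun κ p q h => by rw [← htd_shift]; exact hAs κ p q h)
    (fun l l' n => if l' = q2 then if l = q1 then if n = q3 then 1 else 0 else 0 else 0) p1 p2 p3
  rw [← hu] at l rr y
  rw [l, rr, y]

/-- Coefficients of the finite product `∏_{j<M}(1-q^j t)` up to sign. -/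
def qE (q : ℝ) : ℕ → ℕ → ℝ
  | 0, 0 => 1
  | 0, _ + 1 => 0
  | _ + 1, 0 => 1
  | M + 1, k + 1 => qE q M (k + 1) + q ^ M * qE q M k

/-- The finite product `(q;q)_n`. -/
def qQ (q : ℝ) (n : ℕ) : ℝ := ∏ i ∈ Finset.range n, (1 - q ^ i * q)

lemma qE_zero (q : ℝ) (M : ℕ) : qE q M 0 = 1 := by cases M <;> rfl

lemma qE_gt (q : ℝ) (M k : ℕ) (h : M < k) : qE q M k = 0 := by
  induction M generalizing k with
  | zero =>
    obtain ⟨k, rfl⟩ : ∃ j, k = j + 1 := ⟨k - 1, by omega⟩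
    rfl
  | succ M ih =>
    obtain ⟨k, rfl⟩ : ∃ j, k = j + 1 := ⟨k - 1, by omega⟩
    show qE q M (k + 1) + q ^ M * qE q M k = 0
    rw [ih _ (by omega), ih _ (by omega)]
    ring

lemma prod_qE (q t : ℝ) (M : ℕ) :
    ∏ j ∈ Finset.range M, (1 - q ^ j * t)
      = ∑ k ∈ Finset.range (M + 1), (-t) ^ k * qE q M k := by
  induction M with
  | zero => simp [qE]
  | succ M ih =>
    rw [Finset.prod_range_succ, ih, Finset.sum_range_succ' _ (M + 1)]
    have h1 : ∀ k, (-t) ^ (k + 1) * qE q (M + 1) (k + 1)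
        = (-t) ^ (k + 1) * qE q M (k + 1) + (-t) * q ^ M * ((-t) ^ k * qE q M k) := by
      intro k
      show (-t) ^ (k + 1) * (qE q M (k + 1) + q ^ M * qE q M k) = _
      ring
    rw [Finset.sum_congr rfl fun k _ => h1 k, Finset.sum_add_distrib, ← Finset.mul_sum]
    have h2 : ∑ k ∈ Finset.range (M + 1), (-t) ^ (k + 1) * qE q M (k + 1)
        = ∑ k ∈ Finset.range (M + 1), (-t) ^ k * qE q M k - 1 := by
      have h3 := Finset.sum_range_succ' (fun k => (-t) ^ k * qE q M k) (M + 1)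
      rw [Finset.sum_range_succ, qE_gt q M (M + 1) (by omega), qE_zero] at h3
      linarith
    rw [h2, qE_zero]
    ring

lemma qE_eq (q : ℝ) (hq : 0 < q) (k l : ℕ) :
    qE q (k + l) k * (qQ q k * qQ q l) = q ^ ((k : ℝ) * (k - 1) / 2) * qQ q (k + l) := by
  induction k generalizing l with
  | zero => simp [qE_zero, qQ]
  | succ k ihk =>
    have hQ : ∀ n, qQ q (n + 1) = qQ q n * (1 - q ^ n * q) := fun n => Finset.prod_range_succ _ _
    have he : q ^ (((k + 1 : ℕ) : ℝ) * ((k + 1 : ℕ) - 1) / 2)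
        = q ^ ((k : ℝ) * (k - 1) / 2) * q ^ k := by
      rw [← Real.rpow_natCast q k, ← Real.rpow_add hq]
      congr 1
      push_cast
      ring
    rw [he]
    induction l with
    | zero =>
      have h := ihk 0
      show (qE q k (k + 1) + q ^ k * qE q k k) * _ = _
      rw [qE_gt q k (k + 1) (by omega)]
      simp only [add_zero] at h ⊢
      rw [hQ]
      linear_combination q ^ k * (1 - q ^ k * q) * h
    | succ l ihl =>
      have h := ihk (l + 1)
      have e1 : k + 1 + l = k + (l + 1) := by ring
      have e2 : k + 1 + (l + 1) = k + (l + 1) + 1 := by ring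
      rw [e1] at ihl
      rw [e2]
      show (qE q (k + (l + 1)) (k + 1) + q ^ (k + (l + 1)) * qE q (k + (l + 1)) k) * _ = _
      rw [hQ (k + (l + 1))]
      have h2 : (qE q (k + (l + 1)) (k + 1)) * (qQ q (k + 1) * qQ q (l + 1))
        = (1 - q ^ l * q) * (q ^ ((k : ℝ) * (k - 1) / 2) * q ^ k * qQ q (k + (l + 1))) := by
        rw [← ihl, hQ l]; ring
      have h3 : qE q (k + (l + 1)) k * (qQ q (k + 1) * qQ q (l + 1))
        = (1 - q ^ k * q) * (q ^ ((k : ℝ) * (k - 1) / 2) * qQ q (k + (l + 1))) := by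
        rw [← h, hQ k]; ring
      linear_combination h2 + q ^ (k + (l + 1)) * h3

/-- The terms of the theta series. -/
def tT (q z : ℝ) (n : ℤ) : ℝ := (-z) ^ n * q ^ ((n : ℝ) * (n - 1) / 2)

lemma qQ_pos (q : ℝ) (hq : 0 < q) (hq1 : q < 1) (n : ℕ) : 0 < qQ q n := by
  refine Finset.prod_pos fun i _ => ?_
  have : q ^ i * q < 1 := by
    rw [← pow_succ]; exact pow_lt_one₀ hq.le hq1 (by omega)
  linarith

lemma finite_prod (q z : ℝ) (hq : 0 < q) (hq1 : q < 1) (hz : 0 < z) (N : ℕ) :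
    (∏ j ∈ Finset.range N, (1 - q ^ j * z)) * (∏ j ∈ Finset.range N, (1 - q ^ j * (q / z)))
      = ∑ k ∈ Finset.range (2 * N + 1), tT q z ((k : ℤ) - N) *
        (qQ q (2 * N) / (qQ q k * qQ q (2 * N - k))) := by
  have h := prod_qE q (z * (q ^ N)⁻¹) (N + N)
  rw [Finset.prod_range_add] at h
  have h1 : ∀ j, (1 - q ^ (N + j) * (z * (q ^ N)⁻¹)) = 1 - q ^ j * z := by
    intro j
    rw [pow_add]; field_simp
  simp only [h1] at h
  have h2 : ∀ N : ℕ, ∏ j ∈ Finset.range N, (1 - q ^ j * (z * (q ^ N)⁻¹))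
      = (-z) ^ N * q ^ (-((N : ℝ) * (N + 1) / 2)) *
        ∏ j ∈ Finset.range N, (1 - q ^ j * (q / z)) := by
    intro N
    induction N with
    | zero => simp
    | succ N ih =>
      rw [Finset.prod_range_succ', Finset.prod_range_succ]
      have h3 : ∀ j, (1 - q ^ (j + 1) * (z * (q ^ (N + 1))⁻¹)) = 1 - q ^ j * (z * (q ^ N)⁻¹) := by
        intro j
        rw [pow_succ, pow_succ]; field_simp
      simp only [h3]
      rw [ih]
      have h4 : q ^ (-(((N + 1 : ℕ) : ℝ) * ((N + 1 : ℕ) + 1) / 2))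
          = q ^ (-((N : ℝ) * (N + 1) / 2)) * (q ^ (N + 1))⁻¹ := by
        rw [← Real.rpow_natCast q (N + 1), ← Real.rpow_neg hq.le, ← Real.rpow_add hq]
        congr 1
        push_cast
        ring
      rw [h4]
      field_simp
      ring
  rw [h2] at h
  have hz' : (-z) ^ N ≠ 0 := pow_ne_zero _ (by linarith)
  have hqp : 0 < q ^ (-((N : ℝ) * (N + 1) / 2)) := Real.rpow_pos_of_pos hq _
  have h5 : ∀ k ∈ Finset.range (2 * N + 1), (-(z * (q ^ N)⁻¹)) ^ k * qE q (N + N) k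
      = (-z) ^ N * q ^ (-((N : ℝ) * (N + 1) / 2)) * (tT q z ((k : ℤ) - N) *
        (qQ q (2 * N) / (qQ q k * qQ q (2 * N - k)))) := by
    intro k hk
    rw [Finset.mem_range] at hk
    obtain ⟨l, hl⟩ : ∃ l, N + N = k + l := ⟨N + N - k, by omega⟩
    have e1 : 2 * N - k = l := by omega
    have e2 : 2 * N = k + l := by omega
    have h6 := qE_eq q hq k l
    rw [e1, hl, e2]
    have p1 := qQ_pos q hq hq1 k
    have p2 := qQ_pos q hq hq1 l
    have h7 : qE q (k + l) k = q ^ ((k : ℝ) * (k - 1) / 2) * (qQ q (k + l) / (qQ q k * qQ q l)) := by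
      field_simp
      linarith
    rw [h7, tT, zpow_sub₀ (by linarith), zpow_natCast, zpow_natCast]
    have h8 : q ^ (-((N : ℝ) * (N + 1) / 2)) * q ^ ((((k : ℤ) - N : ℤ) : ℝ) * (((k : ℤ) - N : ℤ) - 1) / 2)
        = q ^ ((k : ℝ) * (k - 1) / 2) * ((q ^ N)⁻¹) ^ k := by
      rw [← Real.rpow_natCast q N, ← Real.rpow_neg hq.le, ← Real.rpow_natCast _ k,
        ← Real.rpow_mul hq.le, ← Real.rpow_add hq, ← Real.rpow_add hq]
      congr 1
      push_cast
      ring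
    have h9 : (-(z * (q ^ N)⁻¹)) ^ k = (-z) ^ k * ((q ^ N)⁻¹) ^ k := by
      rw [← mul_pow]; ring
    rw [h9]
    calc _ = (-z) ^ k * (q ^ ((k : ℝ) * (k - 1) / 2) * ((q ^ N)⁻¹) ^ k) *
          (qQ q (k + l) / (qQ q k * qQ q l)) := by ring
      _ = (-z) ^ k * (q ^ (-((N : ℝ) * (N + 1) / 2)) * q ^ ((((k : ℤ) - N : ℤ) : ℝ) * (((k : ℤ) - N : ℤ) - 1) / 2)) *
          (qQ q (k + l) / (qQ q k * qQ q l)) := by rw [h8]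
      _ = _ := by field_simp
  rw [← two_mul] at h h5
  rw [Finset.sum_congr rfl h5, ← Finset.mul_sum] at h
  have hne : (-z) ^ N * q ^ (-((N : ℝ) * (N + 1) / 2)) ≠ 0 := mul_ne_zero hz' hqp.ne'
  refine mul_left_cancel₀ hne ?_
  rw [← h]
  ring

open Filter Topology in
lemma poch_tendsto (q z : ℝ) (hq : 0 < q) (hq1 : q < 1) :
    Tendsto (fun N => ∏ j ∈ Finset.range N, (1 - q ^ j * z)) atTop (𝓝 (poch z q)) := by
  have hs : Summable (fun j : ℕ => -(q ^ j * z)) :=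
    ((summable_geometric_of_lt_one hq.le hq1).mul_right z).neg
  have hm := Real.multipliable_one_add_of_summable hs
  simp only [← sub_eq_add_neg] at hm
  exact hm.tendsto_prod_tprod_nat

lemma poch_ne (q : ℝ) (hq : 0 < q) (hq1 : q < 1) : poch q q ≠ 0 := by
  have hs : Summable (fun j : ℕ => ‖-(q ^ j * q)‖) :=
    ((summable_geometric_of_lt_one hq.le hq1).mul_right q).neg.norm
  have h := tprod_one_add_ne_zero_of_summable (f := fun j : ℕ => -(q ^ j * q)) (fun j => ?_) hs
  · simpa only [poch, ← sub_eq_add_neg] using h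
  · have : q ^ j * q < 1 := by
      rw [← pow_succ]; exact pow_lt_one₀ hq.le hq1 (by omega)
    intro h0
    linarith

lemma qQ_anti (q : ℝ) (hq : 0 < q) (hq1 : q < 1) : Antitone (qQ q) := by
  refine antitone_nat_of_succ_le fun n => ?_
  have h : qQ q (n + 1) = qQ q n * (1 - q ^ n * q) := Finset.prod_range_succ _ _
  have h1 := qQ_pos q hq hq1 n
  have h2 : 0 < q ^ n * q := by positivity
  rw [h]
  nlinarith

lemma poch_le_qQ (q : ℝ) (hq : 0 < q) (hq1 : q < 1) (n : ℕ) : poch q q ≤ qQ q n :=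
  (qQ_anti q hq hq1).le_of_tendsto (poch_tendsto q q hq hq1) n

lemma poch_pos (q : ℝ) (hq : 0 < q) (hq1 : q < 1) : 0 < poch q q :=
  lt_of_le_of_ne (ge_of_tendsto' (poch_tendsto q q hq hq1) fun n => (qQ_pos q hq hq1 n).le)
    (poch_ne q hq hq1).symm

/-- Gaussian coefficient with integer argument. -/
def gG (q : ℝ) (N : ℕ) (n : ℤ) : ℝ :=
  if n ∈ Finset.Icc (-(N : ℤ)) N then
    qQ q (2 * N) / (qQ q (n + N).toNat * qQ q (N - n).toNat) else 0

lemma finite_prod_tsum (q z : ℝ) (hq : 0 < q) (hq1 : q < 1) (hz : 0 < z) (N : ℕ) :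
    (∏ j ∈ Finset.range N, (1 - q ^ j * z)) * (∏ j ∈ Finset.range N, (1 - q ^ j * (q / z)))
      = ∑' n : ℤ, tT q z n * gG q N n := by
  rw [finite_prod q z hq hq1 hz, tsum_eq_sum (s := Finset.Icc (-(N : ℤ)) N)]
  · refine Finset.sum_bij' (fun k _ => (k : ℤ) - N) (fun n _ => (n + N).toNat) ?_ ?_ ?_ ?_ ?_
    · intro k hk
      simp only [Finset.mem_range, Finset.mem_Icc] at *
      omega
    · intro k hk
      simp only [Finset.mem_range, Finset.mem_Icc] at *
      omega
    · intro k hk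
      simp
    · intro k hk
      simp only [Finset.mem_Icc] at *
      omega
    · intro k hk
      have hm : (k : ℤ) - N ∈ Finset.Icc (-(N : ℤ)) N := by
        simp only [Finset.mem_range, Finset.mem_Icc] at *
        omega
      rw [Finset.mem_range] at hk
      rw [gG, if_pos hm]
      have e1 : ((k : ℤ) - N + N).toNat = k := by omega
      have e2 : ((N : ℤ) - (k - N)).toNat = 2 * N - k := by omega
      rw [e1, e2]
  · intro n hn
    rw [gG, if_neg hn, mul_zero]

open Filter Topology in
lemma gG_tendsto (q : ℝ) (hq : 0 < q) (hq1 : q < 1) (n : ℤ) :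
    Tendsto (fun N => gG q N n) atTop (𝓝 (poch q q)⁻¹) := by
  have hp := poch_pos q hq hq1
  have hQ : Tendsto (qQ q) atTop (𝓝 (poch q q)) := poch_tendsto q q hq hq1
  have t1 : Tendsto (fun N : ℕ => 2 * N) atTop atTop :=
    tendsto_atTop_mono (fun N => by show N ≤ 2 * N; omega) tendsto_id
  have t2 : Tendsto (fun N : ℕ => (n + N).toNat) atTop atTop := by
    refine tendsto_atTop.2 fun b => ?_
    filter_upwards [eventually_ge_atTop (b + n.natAbs)] with N hN
    omega
  have t3 : Tendsto (fun N : ℕ => ((N : ℤ) - n).toNat) atTop atTop := by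
    refine tendsto_atTop.2 fun b => ?_
    filter_upwards [eventually_ge_atTop (b + n.natAbs)] with N hN
    omega
  have h := (hQ.comp t1).div ((hQ.comp t2).mul (hQ.comp t3)) (by positivity)
  have e : poch q q / (poch q q * poch q q) = (poch q q)⁻¹ := by field_simp
  rw [e] at h
  refine h.congr' ?_
  filter_upwards [eventually_ge_atTop n.natAbs] with N hN
  have hm : n ∈ Finset.Icc (-(N : ℤ)) N := by
    simp only [Finset.mem_Icc]
    omega
  rw [gG, if_pos hm]
  rfl

lemma gG_bound (q : ℝ) (hq : 0 < q) (hq1 : q < 1) (N : ℕ) (n : ℤ) :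
    |gG q N n| ≤ (poch q q * poch q q)⁻¹ := by
  have hp := poch_pos q hq hq1
  rw [gG]
  split_ifs
  · have p1 := qQ_pos q hq hq1 (n + N).toNat
    have p2 := qQ_pos q hq hq1 (N - n).toNat
    have p3 := qQ_pos q hq hq1 (2 * N)
    have l1 := poch_le_qQ q hq hq1 (n + N).toNat
    have l2 := poch_le_qQ q hq hq1 (N - n).toNat
    have l3 : qQ q (2 * N) ≤ 1 := by
      have := qQ_anti q hq hq1 (Nat.zero_le (2 * N))
      simpa [qQ] using this
    rw [abs_of_pos (by positivity), ← one_div]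
    gcongr
  · rw [abs_zero]; positivity

open Filter Topology in
lemma theta_eq (q z : ℝ) (hq : 0 < q) (hq1 : q < 1) (hz : 0 < z) (hs : Summable (tT q z)) :
    theta q z = ∑' n : ℤ, tT q z n := by
  have hp := poch_pos q hq hq1
  have h1 := (poch_tendsto q z hq hq1).mul (poch_tendsto q (q / z) hq hq1)
  have h2 : Tendsto (fun N : ℕ => ∑' n : ℤ, tT q z n * gG q N n) atTop
      (𝓝 (∑' n : ℤ, tT q z n * (poch q q)⁻¹)) := by
    refine tendsto_tsum_of_dominated_convergence
      (bound := fun n => |tT q z n| * (poch q q * poch q q)⁻¹) (hs.abs.mul_right _) ?_ ?_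
    · intro n
      exact (gG_tendsto q hq hq1 n).const_mul _
    · refine Eventually.of_forall fun N n => ?_
      rw [Real.norm_eq_abs, abs_mul]
      exact mul_le_mul_of_nonneg_left (gG_bound q hq hq1 N n) (abs_nonneg _)
  have h3 := tendsto_nhds_unique (h1.congr (finite_prod_tsum q z hq hq1 hz)) h2
  rw [tsum_mul_right] at h3
  rw [theta, mul_assoc, h3]
  field_simp

/-- Gaussian term. -/
def gs (x r e c : ℝ) (n : ℤ) : ℝ := x ^ ((c + r * n) ^ 2 * e)

lemma gs_summable (x r e c : ℝ) (hx : 0 < x) (hx1 : x < 1) (hr : 0 < r) (he : 0 < e) :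
    Summable (gs x r e c) := by
  have hL : 0 < -Real.log x := by
    have := Real.log_neg hx hx1
    linarith
  set L := -Real.log x with hLdef
  have hπ := Real.pi_pos
  have hT : 0 < L * e * r ^ 2 / Real.pi := by positivity
  have h := summable_pow_mul_jacobiTheta₂_term_bound (L * e * r * |c| / Real.pi) hT 0
  refine Summable.of_nonneg_of_le (fun n => Real.rpow_nonneg hx.le _) (fun n => ?_) h
  simp only [pow_zero, Int.cast_abs, one_mul]
  rw [gs, Real.rpow_def_of_pos hx]
  refine Real.exp_le_exp.2 ?_
  have hlog : Real.log x = -L := by rw [hLdef]; ring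
  rw [hlog]
  have e1 : -Real.pi * (L * e * r ^ 2 / Real.pi * (n : ℝ) ^ 2 -
      2 * (L * e * r * |c| / Real.pi) * |(n : ℝ)|)
      = -(L * e * (r ^ 2 * (n : ℝ) ^ 2 - 2 * r * (|c| * |(n : ℝ)|))) := by
    field_simp
  rw [e1, ← abs_mul]
  have h2 : -(c * n) ≤ |c * (n : ℝ)| := neg_le_abs _
  have h3 : 0 < L * e := by positivity
  have h4 : r ^ 2 * (n : ℝ) ^ 2 - 2 * r * |c * (n : ℝ)| ≤ (c + r * n) ^ 2 := by
    nlinarith [mul_le_mul_of_nonneg_left h2 hr.le, sq_nonneg c]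
  have h5 := mul_le_mul_of_nonneg_left h4 h3.le
  linarith

/-- The signed theta series. -/
def sS (x r u : ℝ) : ℝ := ∑' n : ℤ, (-1 : ℝ) ^ n * gs x r r⁻¹ (u - r / 2) n

lemma sgn_norm (n : ℤ) : ‖(-1 : ℝ) ^ n‖ = 1 := by simp

lemma sS_summable (x r u : ℝ) (hx : 0 < x) (hx1 : x < 1) (hr : 0 < r) :
    Summable fun n : ℤ => (-1 : ℝ) ^ n * gs x r r⁻¹ (u - r / 2) n := by
  refine Summable.of_norm ?_
  have h := (gs_summable x r r⁻¹ (u - r / 2) hx hx1 hr (by positivity)).norm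
  refine h.congr fun n => ?_
  rw [norm_mul, sgn_norm, one_mul]

lemma bra_eq (x r u : ℝ) (hx : 0 < x) (hx1 : x < 1) (hr : 0 < r) :
    bra x r u = x ^ (-(r / 4)) * sS x r u := by
  have hq : 0 < x ^ (2 * r) := Real.rpow_pos_of_pos hx _
  have hq1 : x ^ (2 * r) < 1 := Real.rpow_lt_one hx.le hx1 (by positivity)
  have hz : 0 < x ^ (2 * u) := Real.rpow_pos_of_pos hx _
  have key : ∀ n : ℤ, (-1 : ℝ) ^ n * gs x r r⁻¹ (u - r / 2) n
      = x ^ (u ^ 2 / r - u + r / 4) * tT (x ^ (2 * r)) (x ^ (2 * u)) n := by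
    intro n
    rw [tT, gs, neg_eq_neg_one_mul (x ^ (2 * u)), mul_zpow, ← Real.rpow_intCast (x ^ (2 * u)) n,
      ← Real.rpow_mul hx.le, ← Real.rpow_mul hx.le]
    have e1 : (u - r / 2 + r * n) ^ 2 * r⁻¹
        = (u ^ 2 / r - u + r / 4) + 2 * u * n + 2 * r * (n * (n - 1) / 2) := by
      field_simp
      ring
    rw [e1, Real.rpow_add hx, Real.rpow_add hx]
    ring
  have hc : 0 < x ^ (u ^ 2 / r - u + r / 4) := Real.rpow_pos_of_pos hx _
  have hs : Summable (tT (x ^ (2 * r)) (x ^ (2 * u))) := by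
    have h := sS_summable x r u hx hx1 hr
    simp only [key] at h
    exact (summable_mul_left_iff hc.ne').1 h
  rw [bra, theta_eq _ _ hq hq1 hz hs, sS]
  simp only [key]
  rw [tsum_mul_left, ← mul_assoc, ← Real.rpow_add hx]
  congr 2
  ring

lemma sS_odd (x r u : ℝ) : sS x r (-u) = -sS x r u := by
  rw [sS, sS, ← (Equiv.subLeft (1 : ℤ)).tsum_eq, ← tsum_neg]
  refine tsum_congr fun n => ?_
  have h1 : (-1 : ℝ) ^ ((Equiv.subLeft (1 : ℤ)) n) = -(-1) ^ n := by
    show (-1 : ℝ) ^ (1 - n) = _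
    rw [zpow_sub₀ (by norm_num), zpow_one]
    rcases Int.even_or_odd n with h | h
    · simp [h.neg_one_zpow]
    · simp [h.neg_one_zpow]
  have h2 : gs x r r⁻¹ (-u - r / 2) ((Equiv.subLeft (1 : ℤ)) n) = gs x r r⁻¹ (u - r / 2) n := by
    show gs x r r⁻¹ (-u - r / 2) (1 - n) = _
    rw [gs, gs]
    congr 1
    push_cast
    ring
  rw [h1, h2]
  ring

/-- Splitting of `ℤ × ℤ` by the parity of the sum of coordinates. -/
def par : (ℤ × ℤ) ⊕ (ℤ × ℤ) → ℤ × ℤ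
  | Sum.inl p => (p.1 + 1 + p.2, p.1 + 1 - p.2)
  | Sum.inr p => (p.1 + 1 + p.2, p.1 - p.2)

lemma par_bij : Function.Bijective par := by
  constructor
  · rintro (⟨i, j⟩ | ⟨i, j⟩) (⟨k, l⟩ | ⟨k, l⟩) h <;>
    simp only [par, Prod.mk.injEq, Sum.inl.injEq, Sum.inr.injEq, reduceCtorEq] at h ⊢ <;> omega
  · rintro ⟨m, n⟩
    rcases Int.even_or_odd' (m + n) with ⟨k, h | h⟩
    · refine ⟨Sum.inl (k - 1, m - k), ?_⟩
      simp only [par, Prod.mk.injEq]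
      omega
    · refine ⟨Sum.inr (k, m - k - 1), ?_⟩
      simp only [par, Prod.mk.injEq]
      omega

/-- Even theta series. -/
def sE (x r X : ℝ) : ℝ := ∑' n : ℤ, gs x r (2 * r⁻¹) X n

/-- Odd theta series. -/
def sO (x r X : ℝ) : ℝ := ∑' n : ℤ, gs x r (2 * r⁻¹) (X + r / 2) n

lemma sS_mul (x r X Y : ℝ) (hx : 0 < x) (hx1 : x < 1) (hr : 0 < r) :
    sS x r (X + Y) * sS x r (X - Y) = sO x r X * sE x r Y - sE x r X * sO x r Y := by
  have hr' : 0 < 2 * r⁻¹ := by positivity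
  have s1 := sS_summable x r (X + Y) hx hx1 hr
  have s2 := sS_summable x r (X - Y) hx hx1 hr
  have s12 := summable_mul_of_summable_norm s1.norm s2.norm
  have o1 := gs_summable x r (2 * r⁻¹) (X + r / 2) hx hx1 hr hr'
  have o2 := gs_summable x r (2 * r⁻¹) (Y + r / 2) hx hx1 hr hr'
  have e1 := gs_summable x r (2 * r⁻¹) X hx hx1 hr hr'
  have e2 := gs_summable x r (2 * r⁻¹) Y hx hx1 hr hr'
  have oe := (summable_mul_of_summable_norm o1.norm e2.norm).hasSum
  have eo : HasSum (fun b : ℤ × ℤ => -(gs x r (2 * r⁻¹) X b.1 * gs x r (2 * r⁻¹) (Y + r / 2) b.2))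
      (-∑' b : ℤ × ℤ, gs x r (2 * r⁻¹) X b.1 * gs x r (2 * r⁻¹) (Y + r / 2) b.2) :=
    (summable_mul_of_summable_norm e1.norm o2.norm).hasSum.neg
  rw [sS, sS, sO, sE, sE, sO, tsum_mul_tsum_of_summable_norm s1.norm s2.norm,
    tsum_mul_tsum_of_summable_norm o1.norm e2.norm, tsum_mul_tsum_of_summable_norm e1.norm o2.norm,
    ← (Equiv.ofBijective par par_bij).tsum_eq, sub_eq_add_neg]
  refine HasSum.tsum_eq ?_
  refine HasSum.sum ?_ ?_
  · convert oe using 1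
    funext p
    revert p
    rintro ⟨i, j⟩
    show (-1 : ℝ) ^ (i + 1 + j) * gs x r r⁻¹ (X + Y - r / 2) (i + 1 + j) *
      ((-1 : ℝ) ^ (i + 1 - j) * gs x r r⁻¹ (X - Y - r / 2) (i + 1 - j)) =
      gs x r (2 * r⁻¹) (X + r / 2) i * gs x r (2 * r⁻¹) Y j
    rw [mul_mul_mul_comm, ← zpow_add₀ (by norm_num), Even.neg_one_zpow ⟨i + 1, by ring⟩, one_mul]
    simp only [gs]
    rw [← Real.rpow_add hx, ← Real.rpow_add hx]
    congr 1
    push_cast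
    ring
  · refine Eq.mpr (congrArg (fun F : ℤ × ℤ → ℝ => HasSum F _) (funext ?_)) eo
    rintro ⟨i, j⟩
    show (-1 : ℝ) ^ (i + 1 + j) * gs x r r⁻¹ (X + Y - r / 2) (i + 1 + j) *
      ((-1 : ℝ) ^ (i - j) * gs x r r⁻¹ (X - Y - r / 2) (i - j)) =
      -(gs x r (2 * r⁻¹) X i * gs x r (2 * r⁻¹) (Y + r / 2) j)
    rw [mul_mul_mul_comm, ← zpow_add₀ (by norm_num), Odd.neg_one_zpow ⟨i, by ring⟩,
      neg_one_mul]
    simp only [gs]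
    rw [← Real.rpow_add hx, ← Real.rpow_add hx]
    congr 2
    push_cast
    ring

lemma weier_bra (x r : ℝ) (hx : 0 < x) (hx1 : x < 1) (hr : 0 < r) : Weier (bra x r) := by
  intro X Y Z T
  have h : ∀ X Y, bra x r (X + Y) * bra x r (X - Y) = x ^ (-(r / 4)) * x ^ (-(r / 4)) *
      (sO x r X * sE x r Y - sE x r X * sO x r Y) := by
    intro X Y
    rw [bra_eq _ _ _ hx hx1 hr, bra_eq _ _ _ hx hx1 hr, ← sS_mul x r X Y hx hx1 hr]
    ring
  rw [mul_assoc, mul_assoc _ (bra x r (Y + T)), mul_assoc _ (bra x r (Y + Z)), h X Y, h Z T,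
    h X Z, h Y T, h X T, h Y Z]
  ring

lemma odd_bra (x r : ℝ) (hx : 0 < x) (hx1 : x < 1) (hr : 0 < r) (a : ℝ) :
    bra x r (-a) = -bra x r a := by
  rw [bra_eq _ _ _ hx hx1 hr, bra_eq _ _ _ hx hx1 hr, sS_odd]
  ring

/-- **Yang–Baxter equation** for the bulk Boltzmann weights of the
`U_{q,p}(sl₃)` ABF model. -/
theorem bulk_yang_baxter
    (x : ℝ) (hx0 : 0 < x) (hx1 : x < 1) (r : ℤ) (hr : 5 ≤ r)
    (u₁ u₂ : ℝ) (a b c d e f : V)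
    (ha : a ∈ P) (hb : b ∈ P) (hc : c ∈ P) (hd : d ∈ P) (he : e ∈ P) (hf : f ∈ P)
    (hden₁ : bra x r (u₁ - 1) ≠ 0) (hden₂ : bra x r (u₂ - 1) ≠ 0)
    (hden₁₂ : bra x r (u₁ - u₂ - 1) ≠ 0)
    (hdenH : ∀ g : V,
      (g = a ∨ g = b ∨ g = c ∨ g = d ∨ g = e ∨ g = f ∨ (∃ κ : Fin 3, g = a + epsbar κ)) →
      ∀ μ ν : Fin 3, μ ≠ ν → bra x r (htd g μ ν) ≠ 0) :
    ∑ᶠ g : P, W x r d e c (g : V) u₁ * W x r c (g : V) b a u₂ * W x r e f (g : V) a (u₁ - u₂)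
      = ∑ᶠ g : P,
          W x r (g : V) f b a u₁ * W x r d e (g : V) f u₂ * W x r d (g : V) c b (u₁ - u₂) := by
  have hr0 : (0 : ℝ) < (r : ℝ) := by
    have : (0 : ℤ) < r := by omega
    exact_mod_cast this
  exact ybe_of_weier x r (odd_bra x r hx0 hx1 hr0) (weier_bra x r hx0 hx1 hr0) u₁ u₂ a b c d e f
    ha hb hden₁ hden₂ hden₁₂ (hdenH a (Or.inl rfl))
    (fun κ => hdenH (a + epsbar κ)
      (Or.inr (Or.inr (Or.inr (Or.inr (Or.inr (Or.inr ⟨κ, rfl⟩)))))))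

end ABF
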